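/- arXiv:alg-geom/9310003 — 9 statements merged into one kernel-verified Lean document; each statement's English description precedes it below -/
import Mathlib

section
/- Let Δ ⊆ ℝⁿ be a reflexive polytope. For a proper face Θ of Δ define Θ* = {y ∈ Δ* : ⟨x, y⟩ = -1 for all x ∈ Θ}. Then Θ ↦ Θ* is a bijection from the set of nonempty proper faces of Δ to the set of nonempty proper faces of Δ*, it reverses inclusion (Θ₁ ⊆ Θ₂ if and only if Θ₂* ⊆ Θ₁*), it satisfies (Θ*)* = Θ, and the dimensions of the affine spans satisfy dim Θ + dim Θ* = n - 1. -/
open Finset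

/-- The dual set `P* = {y | ⟨x, y⟩ ≥ -1 for all x ∈ P}` of a subset of `ℝⁿ`. -/
def dualSet {n : ℕ} (P : Set (Fin n → ℝ)) : Set (Fin n → ℝ) :=
  {y | ∀ x ∈ P, -1 ≤ ∑ i, x i * y i}

/-- A point of `ℝⁿ` lies in the standard lattice `ℤⁿ` iff all its coordinates are integers. -/
def IsLatticePoint {n : ℕ} (x : Fin n → ℝ) : Prop := ∀ i, ∃ m : ℤ, x i = m

/-- A lattice polytope is the convex hull of a finite set of lattice points. -/
def IsLatticePolytope {n : ℕ} (Δ : Set (Fin n → ℝ)) : Prop :=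
  ∃ V : Finset (Fin n → ℝ), (∀ v ∈ V, IsLatticePoint v) ∧
    Δ = convexHull ℝ (V : Set (Fin n → ℝ))

/-- A reflexive polytope: a lattice polytope with `0` in its topological interior whose
dual set is again a lattice polytope. -/
def IsReflexive {n : ℕ} (Δ : Set (Fin n → ℝ)) : Prop :=
  IsLatticePolytope Δ ∧ (0 : Fin n → ℝ) ∈ interior Δ ∧ IsLatticePolytope (dualSet Δ)

/-- A nonempty proper exposed face of a polytope `Δ`:
`F = Δ ∩ {x : ⟨x, u⟩ = max_{z ∈ Δ} ⟨z, u⟩}` for some `u`, with `F ≠ Δ` and `F ≠ ∅`. -/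
def IsProperFace {n : ℕ} (Δ F : Set (Fin n → ℝ)) : Prop :=
  F.Nonempty ∧ F ≠ Δ ∧
    ∃ u : Fin n → ℝ, F = {x ∈ Δ | ∀ z ∈ Δ, ∑ i, z i * u i ≤ ∑ i, x i * u i}

/-- The dual face `Θ* = {y ∈ Δ* : ⟨x, y⟩ = -1 for all x ∈ Θ}` of a face `Θ ⊆ Δ`. -/
def faceDual {n : ℕ} (Δ Θ : Set (Fin n → ℝ)) : Set (Fin n → ℝ) :=
  {y ∈ dualSet Δ | ∀ x ∈ Θ, ∑ i, x i * y i = -1}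

open Matrix in
theorem mem_dualSet_iff {n : ℕ} {P : Set (Fin n → ℝ)} {y : Fin n → ℝ} :
    y ∈ dualSet P ↔ ∀ x ∈ P, -1 ≤ x ⬝ᵥ y := Iff.rfl

open Matrix in
theorem mem_faceDual_iff {n : ℕ} {Δ Θ : Set (Fin n → ℝ)} {y : Fin n → ℝ} :
    y ∈ faceDual Δ Θ ↔ y ∈ dualSet Δ ∧ ∀ x ∈ Θ, x ⬝ᵥ y = -1 := Iff.rfl

theorem faceDual_anti {n : ℕ} {Δ Θ₁ Θ₂ : Set (Fin n → ℝ)} (h : Θ₁ ⊆ Θ₂) :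
    faceDual Δ Θ₂ ⊆ faceDual Δ Θ₁ := fun _ hy => ⟨hy.1, fun x hx => hy.2 x (h hx)⟩

open Matrix in
theorem convex_setOf_le_dotProduct {n : ℕ} (c : ℝ) (y : Fin n → ℝ) :
    Convex ℝ {x : Fin n → ℝ | c ≤ x ⬝ᵥ y} :=
  convex_halfSpace_ge (f := fun x : Fin n → ℝ => x ⬝ᵥ y)
    ⟨fun a b => add_dotProduct a b y, fun r a => smul_dotProduct r a y⟩ c

open Matrix in
theorem mem_dualSet_convexHull {n : ℕ} {V : Set (Fin n → ℝ)} {y : Fin n → ℝ} :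
    y ∈ dualSet (convexHull ℝ V) ↔ ∀ x ∈ V, -1 ≤ x ⬝ᵥ y :=
  ⟨fun h x hx => h x (subset_convexHull ℝ V hx),
    fun h _ hx => convexHull_min h (convex_setOf_le_dotProduct (-1) y) hx⟩

open Matrix in
theorem dualSet_dualSet {n : ℕ} {Δ : Set (Fin n → ℝ)} (hc : Convex ℝ Δ) (hcl : IsClosed Δ)
    (h0 : (0 : Fin n → ℝ) ∈ Δ) : dualSet (dualSet Δ) = Δ := by
  ext x
  refine ⟨fun hx => ?_, fun hx y hy => ?_⟩
  · by_contra hxΔ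
    obtain ⟨f, s, hs, hsx⟩ := geometric_hahn_banach_closed_point hc hcl hxΔ
    have hs0 : 0 < s := by simpa using hs 0 h0
    obtain ⟨w, hw⟩ := (dotProductEquiv ℝ (Fin n)).surjective f.toLinearMap
    have hfw : ∀ a, f a = w ⬝ᵥ a := fun a => by
      have := congrArg (fun g : Module.Dual ℝ (Fin n → ℝ) => g a) hw
      simpa using this.symm
    have hmem : (-s⁻¹) • w ∈ dualSet Δ := by
      rw [mem_dualSet_iff]
      intro a ha
      have h1 := hs a ha
      rw [hfw, dotProduct_comm] at h1
      have h2 : s⁻¹ * (a ⬝ᵥ w) < 1 := by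
        rw [inv_mul_lt_iff₀ hs0]; linarith
      simp only [dotProduct_smul, smul_eq_mul]
      linarith
    have h1 : -1 ≤ ((-s⁻¹) • w) ⬝ᵥ x := hx _ hmem
    rw [hfw] at hsx
    have h2 : 1 < s⁻¹ * (w ⬝ᵥ x) := by
      rw [lt_inv_mul_iff₀ hs0]; linarith
    simp only [smul_dotProduct, smul_eq_mul] at h1
    linarith
  · have h : -1 ≤ x ⬝ᵥ y := hy x hx
    rwa [dotProduct_comm] at h

open Matrix in
theorem zero_mem_interior_dualSet {n : ℕ} (V : Finset (Fin n → ℝ)) :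
    (0 : Fin n → ℝ) ∈ interior (dualSet (convexHull ℝ (V : Set (Fin n → ℝ)))) := by
  rw [mem_interior]
  refine ⟨⋂ v ∈ V, {y : Fin n → ℝ | -1 < v ⬝ᵥ y}, fun y hy => ?_, ?_, ?_⟩
  · rw [mem_dualSet_convexHull]
    exact fun v hv => le_of_lt (by simpa using Set.mem_iInter₂.1 hy v hv)
  · exact isOpen_biInter_finset fun v _ => isOpen_lt continuous_const (by fun_prop)
  · simp

theorem IsLatticePolytope.dualSet_dualSet {n : ℕ} {Δ : Set (Fin n → ℝ)}
    (h : IsLatticePolytope Δ) (h0 : (0 : Fin n → ℝ) ∈ Δ) : dualSet (dualSet Δ) = Δ := by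
  obtain ⟨V, -, rfl⟩ := h
  exact _root_.dualSet_dualSet (convex_convexHull ℝ _)
    (V.finite_toSet.isClosed_convexHull ℝ) h0

theorem IsReflexive.dualSet {n : ℕ} {Δ : Set (Fin n → ℝ)} (h : IsReflexive Δ) :
    IsReflexive (dualSet Δ) := by
  refine ⟨h.2.2, ?_, ?_⟩
  · obtain ⟨⟨V, -, rfl⟩, -⟩ := h
    exact zero_mem_interior_dualSet V
  · rw [h.1.dualSet_dualSet (interior_subset h.2.1)]
    exact h.1

open Matrix in
/-- A proper face of a set with `0` in its interior is cut out by a point of the dual set. -/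
theorem IsProperFace.exists_mem_dualSet {n : ℕ} {Δ Θ : Set (Fin n → ℝ)}
    (h0 : (0 : Fin n → ℝ) ∈ interior Δ) (h : IsProperFace Δ Θ) :
    ∃ y ∈ dualSet Δ, Θ = {x ∈ Δ | x ⬝ᵥ y = -1} := by
  obtain ⟨⟨x₀, hx₀⟩, hne, u, hu⟩ := h
  have hx₀' : x₀ ∈ Δ ∧ ∀ z ∈ Δ, z ⬝ᵥ u ≤ x₀ ⬝ᵥ u := by
    rw [hu] at hx₀; exact hx₀
  obtain ⟨hx₀Δ, hmax⟩ := hx₀'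
  have hu0 : u ≠ 0 := by
    rintro rfl
    exact hne (by rw [hu]; simp)
  have hpos : 0 < x₀ ⬝ᵥ u := by
    have hcont : Filter.Tendsto (fun t : ℝ => t • u) (nhds 0) (nhds 0) :=
      Continuous.tendsto' (by fun_prop) _ _ (by simp)
    have hev := hcont.eventually (mem_interior_iff_mem_nhds.1 h0)
    obtain ⟨t, ht, htpos⟩ := ((hev.filter_mono nhdsWithin_le_nhds).and
      (self_mem_nhdsWithin (a := (0 : ℝ)) (s := Set.Ioi 0))).exists
    refine lt_of_lt_of_le ?_ (hmax _ ht)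
    rw [smul_dotProduct, smul_eq_mul]
    refine mul_pos htpos (lt_of_le_of_ne (Finset.sum_nonneg fun i _ => mul_self_nonneg _) ?_)
    exact fun h => hu0 (dotProduct_self_eq_zero.1 h.symm)
  refine ⟨(-(x₀ ⬝ᵥ u)⁻¹) • u, ?_, ?_⟩
  · rw [mem_dualSet_iff]
    intro z hz
    have : (x₀ ⬝ᵥ u)⁻¹ * (z ⬝ᵥ u) ≤ 1 := by
      rw [inv_mul_le_iff₀ hpos]; linarith [hmax z hz]
    simp only [dotProduct_smul, smul_eq_mul]
    linarith
  · rw [hu]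
    ext x
    simp only [Set.mem_ofPred_eq]
    refine and_congr_right fun hx => ?_
    change (∀ z ∈ Δ, z ⬝ᵥ u ≤ x ⬝ᵥ u) ↔ _
    have heq : x ⬝ᵥ ((-(x₀ ⬝ᵥ u)⁻¹) • u) = -1 ↔ x ⬝ᵥ u = x₀ ⬝ᵥ u := by
      simp only [dotProduct_smul, smul_eq_mul, neg_mul, neg_inj]
      rw [inv_mul_eq_one₀ hpos.ne', eq_comm]
    rw [heq]
    exact ⟨fun h => le_antisymm (hmax x hx) (h _ hx₀Δ), fun h z hz => h ▸ hmax z hz⟩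

open Matrix in
/-- A point of a polytope lying on a supporting hyperplane pairs to `-1` with every `z` for which
the vertices on that hyperplane do. -/
theorem dotProduct_eq_neg_one_of_vertices {n : ℕ} {V : Set (Fin n → ℝ)} {y z x : Fin n → ℝ}
    (hy : y ∈ dualSet (convexHull ℝ V)) (hz : ∀ v ∈ V, v ⬝ᵥ y = -1 → v ⬝ᵥ z = -1)
    (hx : x ∈ convexHull ℝ V) (hxy : x ⬝ᵥ y = -1) : x ⬝ᵥ z = -1 := by
  rw [mem_dualSet_convexHull] at hy
  rw [_root_.convexHull_eq] at hx
  obtain ⟨ι, t, w, p, hw0, hw1, hp, rfl⟩ := hx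
  rw [Finset.centerMass_eq_of_sum_1 _ _ hw1] at hxy ⊢
  simp only [sum_dotProduct, smul_dotProduct, smul_eq_mul] at hxy ⊢
  have hsum : ∑ i ∈ t, w i * (p i ⬝ᵥ y + 1) = 0 := by
    simp [mul_add, Finset.sum_add_distrib, hxy, hw1]
  rw [Finset.sum_eq_zero_iff_of_nonneg fun i hi =>
    mul_nonneg (hw0 i hi) (by linarith [hy _ (hp i hi)])] at hsum
  rw [← neg_eq_iff_eq_neg, ← Finset.sum_neg_distrib, ← hw1]
  refine Finset.sum_congr rfl fun i hi => ?_
  rcases mul_eq_zero.1 (hsum i hi) with h | h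
  · simp [h]
  · rw [hz _ (hp i hi) (by linarith)]; ring

open Matrix in
theorem isProperFace_faceDual {n : ℕ} {Δ Θ : Set (Fin n → ℝ)} (hΔ : IsLatticePolytope Δ)
    (h0 : (0 : Fin n → ℝ) ∈ interior Δ) (hΘ : IsProperFace Δ Θ) :
    IsProperFace (dualSet Δ) (faceDual Δ Θ) := by
  classical
  obtain ⟨V, -, rfl⟩ := hΔ
  obtain ⟨y, hy, hΘy⟩ := hΘ.exists_mem_dualSet h0
  obtain ⟨x₀, hx₀⟩ := hΘ.1
  have hx₀' := hx₀
  rw [hΘy] at hx₀'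
  have hyΘ : y ∈ faceDual (convexHull ℝ (V : Set (Fin n → ℝ))) Θ :=
    ⟨hy, fun x hx => by rw [hΘy] at hx; exact hx.2⟩
  have hyv := mem_dualSet_convexHull.1 hy
  set F := V.filter fun v => v ⬝ᵥ y = -1 with hF
  have hFne : F.Nonempty := by
    by_contra hne
    rw [Finset.not_nonempty_iff_eq_empty, Finset.filter_eq_empty_iff] at hne
    have := dotProduct_eq_neg_one_of_vertices (z := 0) hy
      (fun v hv h => absurd h (hne hv)) hx₀'.1 hx₀'.2
    simp at this
  have hle : ∀ z ∈ dualSet (convexHull ℝ (V : Set (Fin n → ℝ))),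
      z ⬝ᵥ (-∑ v ∈ F, v) ≤ F.card := fun z hz => by
    rw [mem_dualSet_convexHull] at hz
    rw [dotProduct_neg, dotProduct_sum, ← Finset.sum_neg_distrib]
    refine (Finset.sum_le_card_nsmul F _ 1 fun v hv => ?_).trans (by simp)
    rw [dotProduct_comm]
    linarith [hz v (Finset.mem_filter.1 hv).1]
  have heq : ∀ z, (∀ v ∈ F, v ⬝ᵥ z = -1) → z ⬝ᵥ (-∑ v ∈ F, v) = F.card := fun z hz => by
    rw [dotProduct_neg, dotProduct_sum, ← Finset.sum_neg_distrib,
      Finset.sum_congr rfl fun v hv => by rw [dotProduct_comm, hz v hv]]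
    simp
  refine ⟨⟨y, hyΘ⟩, fun h => ?_, -∑ v ∈ F, v, ?_⟩
  · have h0' : (0 : Fin n → ℝ) ∈ faceDual (convexHull ℝ (V : Set (Fin n → ℝ))) Θ := by
      rw [h]; exact interior_subset (zero_mem_interior_dualSet V)
    have := (mem_faceDual_iff.1 h0').2 _ hx₀
    simp at this
  · ext z
    refine and_congr_right fun hz => ?_
    change (∀ x ∈ Θ, x ⬝ᵥ z = -1) ↔ ∀ w ∈ _, w ⬝ᵥ (-∑ v ∈ F, v) ≤ z ⬝ᵥ (-∑ v ∈ F, v)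
    constructor
    · intro h w hw
      refine (hle w hw).trans (heq z fun v hv => h v ?_).ge
      rw [hΘy]
      exact ⟨subset_convexHull ℝ _ (Finset.mem_filter.1 hv).1, (Finset.mem_filter.1 hv).2⟩
    · intro h
      have h1 := (heq y fun v hv => (Finset.mem_filter.1 hv).2).ge.trans (h y hy)
      rw [dotProduct_comm, neg_dotProduct, sum_dotProduct] at h1
      have hz' := mem_dualSet_convexHull.1 hz
      have hnn : ∀ v ∈ F, 0 ≤ v ⬝ᵥ z + 1 := fun v hv => by
        linarith [hz' v (Finset.mem_filter.1 hv).1]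
      have hsum : ∑ v ∈ F, (v ⬝ᵥ z + 1) = 0 := by
        refine le_antisymm ?_ (Finset.sum_nonneg hnn)
        rw [Finset.sum_add_distrib, Finset.sum_const, nsmul_eq_mul]
        linarith
      rw [Finset.sum_eq_zero_iff_of_nonneg hnn] at hsum
      intro x hx
      rw [hΘy] at hx
      exact dotProduct_eq_neg_one_of_vertices hy
        (fun v hv hvy => by linarith [hsum v (Finset.mem_filter.2 ⟨hv, hvy⟩)]) hx.1 hx.2

open Matrix in
theorem faceDual_faceDual {n : ℕ} {Δ Θ : Set (Fin n → ℝ)} (hΔ : IsLatticePolytope Δ)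
    (h0 : (0 : Fin n → ℝ) ∈ interior Δ) (hΘ : IsProperFace Δ Θ) :
    faceDual (dualSet Δ) (faceDual Δ Θ) = Θ := by
  obtain ⟨y, hy, hΘy⟩ := hΘ.exists_mem_dualSet h0
  ext x
  rw [mem_faceDual_iff, hΔ.dualSet_dualSet (interior_subset h0)]
  constructor
  · rintro ⟨hx, h⟩
    rw [hΘy]
    refine ⟨hx, ?_⟩
    rw [dotProduct_comm]
    exact h y ⟨hy, fun z hz => by rw [hΘy] at hz; exact hz.2⟩
  · refine fun hx => ⟨by rw [hΘy] at hx; exact hx.1, fun z hz => ?_⟩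
    rw [dotProduct_comm]
    exact hz.2 x hx

/-- A set on which a linear form is constantly nonzero has linear span of dimension one more than
its affine span. -/
theorem finrank_span_eq_finrank_vectorSpan_add_one {E : Type*} [AddCommGroup E] [Module ℝ E]
    [FiniteDimensional ℝ E] {S : Set E} (hS : S.Nonempty) (f : E →ₗ[ℝ] ℝ) {c : ℝ} (hc : c ≠ 0)
    (hf : ∀ x ∈ S, f x = c) :
    Module.finrank ℝ (Submodule.span ℝ S) = Module.finrank ℝ (vectorSpan ℝ S) + 1 := by
  obtain ⟨p, hp⟩ := hS
  have hker : vectorSpan ℝ S ≤ LinearMap.ker f := by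
    rw [vectorSpan_def, Submodule.span_le]
    rintro _ ⟨a, ha, b, hb, rfl⟩
    simp [hf a ha, hf b hb]
  have hp0 : p ≠ 0 := by
    rintro rfl
    exact hc (by rw [← hf 0 hp, map_zero])
  have hpn : p ∉ vectorSpan ℝ S := fun h => hc (by
    rw [← hf p hp]; exact hker h)
  have hsup : Submodule.span ℝ S = vectorSpan ℝ S ⊔ Submodule.span ℝ {p} := by
    apply le_antisymm
    · rw [Submodule.span_le]
      intro a ha
      rw [← sub_add_cancel a p]
      exact Submodule.add_mem_sup (vsub_mem_vectorSpan ℝ ha hp) (Submodule.mem_span_singleton_self p)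
    · refine sup_le ?_ (Submodule.span_mono (by simpa using hp))
      rw [vectorSpan_def, Submodule.span_le]
      rintro _ ⟨a, ha, b, hb, rfl⟩
      exact Submodule.sub_mem _ (Submodule.subset_span ha) (Submodule.subset_span hb)
  rw [hsup]
  have h1 := Submodule.finrank_sup_add_finrank_inf_eq (vectorSpan ℝ S) (Submodule.span ℝ {p})
  have hinf : vectorSpan ℝ S ⊓ Submodule.span ℝ {p} = ⊥ :=
    disjoint_iff.1 ((Submodule.disjoint_span_singleton' hp0).2 hpn)
  rw [hinf, finrank_bot, finrank_span_singleton hp0] at h1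
  simpa using h1

open Matrix in
theorem vectorSpan_faceDual {n : ℕ} {Δ Θ : Set (Fin n → ℝ)} (hΔ : IsLatticePolytope Δ)
    (h0 : (0 : Fin n → ℝ) ∈ interior Δ) (hΘ : IsProperFace Δ Θ) :
    vectorSpan ℝ (faceDual Δ Θ) =
      (Submodule.span ℝ Θ).dualAnnihilator.comap (dotProductEquiv ℝ (Fin n)).toLinearMap := by
  obtain ⟨V, -, rfl⟩ := hΔ
  obtain ⟨y, hy, hΘy⟩ := hΘ.exists_mem_dualSet h0
  have hyv := mem_dualSet_convexHull.1 hy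
  have hyΘ : y ∈ faceDual (convexHull ℝ (V : Set (Fin n → ℝ))) Θ :=
    ⟨hy, fun x hx => by rw [hΘy] at hx; exact hx.2⟩
  apply le_antisymm
  · rw [vectorSpan_def, Submodule.span_le]
    rintro _ ⟨a, ha, b, hb, rfl⟩
    simp only [Submodule.comap_coe, Set.mem_preimage, SetLike.mem_coe,
      Submodule.mem_dualAnnihilator]
    intro x hx
    induction hx using Submodule.span_induction with
    | mem x hx =>
      have h1 : x ⬝ᵥ a = -1 := ha.2 x hx
      have h2 : x ⬝ᵥ b = -1 := hb.2 x hx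
      simp [dotProduct_comm _ x, h1, h2]
    | zero => simp
    | add _ _ _ _ h1 h2 => rw [map_add, h1, h2, add_zero]
    | smul _ _ _ h => rw [map_smul, h, smul_zero]
  · intro w hw
    simp only [Submodule.mem_comap, Submodule.mem_dualAnnihilator] at hw
    have hwΘ : ∀ x ∈ Θ, x ⬝ᵥ w = 0 := fun x hx => by
      have := hw x (Submodule.subset_span hx)
      rw [dotProduct_comm]
      simpa using this
    have hev : ∀ᶠ t : ℝ in nhds 0, ∀ v ∈ V, -1 ≤ v ⬝ᵥ (y + t • w) := by
      rw [Filter.eventually_all_finset]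
      intro v hv
      by_cases hvy : v ⬝ᵥ y = -1
      · refine Filter.Eventually.of_forall fun t => ?_
        have : v ⬝ᵥ w = 0 := hwΘ v (by rw [hΘy]; exact ⟨subset_convexHull ℝ _ hv, hvy⟩)
        simp [dotProduct_add, hvy, this]
      · have hlt : -1 < v ⬝ᵥ (y + (0 : ℝ) • w) := by
          simpa using lt_of_le_of_ne (hyv v hv) (Ne.symm hvy)
        have hc : Continuous fun t : ℝ => v ⬝ᵥ (y + t • w) := by fun_prop
        exact (hc.continuousAt.eventually (lt_mem_nhds hlt)).mono fun _ h => h.le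
    obtain ⟨t, ht, htpos⟩ := ((hev.filter_mono nhdsWithin_le_nhds).and
      (self_mem_nhdsWithin (a := (0 : ℝ)) (s := Set.Ioi 0))).exists
    have hmem : y + t • w ∈ faceDual (convexHull ℝ (V : Set (Fin n → ℝ))) Θ := by
      refine mem_faceDual_iff.2 ⟨mem_dualSet_convexHull.2 ht, fun x hx => ?_⟩
      have : x ⬝ᵥ y = -1 := hyΘ.2 x hx
      simp [dotProduct_add, this, hwΘ x hx]
    have h := vsub_mem_vectorSpan ℝ hmem hyΘ
    rw [vsub_eq_sub, add_sub_cancel_left] at h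
    exact (Submodule.smul_mem_iff _ (ne_of_gt htpos)).1 h

open Matrix in
theorem finrank_vectorSpan_add_finrank_vectorSpan_faceDual {n : ℕ} {Δ Θ : Set (Fin n → ℝ)}
    (hΔ : IsLatticePolytope Δ) (h0 : (0 : Fin n → ℝ) ∈ interior Δ) (hΘ : IsProperFace Δ Θ) :
    Module.finrank ℝ (vectorSpan ℝ Θ) + Module.finrank ℝ (vectorSpan ℝ (faceDual Δ Θ)) =
      n - 1 := by
  obtain ⟨y, hy, hΘy⟩ := hΘ.exists_mem_dualSet h0
  have h1 := finrank_span_eq_finrank_vectorSpan_add_one hΘ.1 (dotProductEquiv ℝ (Fin n) y)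
    (c := -1) (by norm_num) (fun x hx => by
      rw [hΘy] at hx
      simpa [dotProduct_comm] using hx.2)
  have h2 := Subspace.finrank_add_finrank_dualAnnihilator_eq (Submodule.span ℝ Θ)
  rw [Module.finrank_fin_fun] at h2
  rw [vectorSpan_faceDual hΔ h0 hΘ, Submodule.comap_equiv_eq_map_symm,
    LinearEquiv.finrank_map_eq]
  omega

/-- The combinatorial duality between proper faces of a reflexive polytope `Δ` and proper
faces of its dual `Δ*`: `Θ ↦ Θ*` is an inclusion-reversing involutive bijection with
`dim Θ + dim Θ* = n - 1`. -/
theorem face_duality_of_reflexive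
    (n : ℕ) (hn : 1 ≤ n) (Δ : Set (Fin n → ℝ)) (hΔ : IsReflexive Δ) :
    (∀ Θ, IsProperFace Δ Θ → IsProperFace (dualSet Δ) (faceDual Δ Θ)) ∧
    (∀ Θ₁ Θ₂, IsProperFace Δ Θ₁ → IsProperFace Δ Θ₂ →
      (Θ₁ ⊆ Θ₂ ↔ faceDual Δ Θ₂ ⊆ faceDual Δ Θ₁)) ∧
    (∀ Θ, IsProperFace Δ Θ → faceDual (dualSet Δ) (faceDual Δ Θ) = Θ) ∧
    (∀ Ξ, IsProperFace (dualSet Δ) Ξ → ∃ Θ, IsProperFace Δ Θ ∧ faceDual Δ Θ = Ξ) ∧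
    (∀ Θ, IsProperFace Δ Θ →
      Module.finrank ℝ (affineSpan ℝ Θ).direction +
        Module.finrank ℝ (affineSpan ℝ (faceDual Δ Θ)).direction = n - 1) := by
  obtain ⟨hP, h0, hD⟩ := id hΔ
  obtain ⟨-, h0', -⟩ := hΔ.dualSet
  have hdd := hP.dualSet_dualSet (interior_subset h0)
  refine ⟨fun Θ hΘ => isProperFace_faceDual hP h0 hΘ, fun Θ₁ Θ₂ h₁ h₂ =>
    ⟨faceDual_anti, fun h => ?_⟩, fun Θ hΘ => faceDual_faceDual hP h0 hΘ, fun Ξ hΞ =>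
    ⟨faceDual (dualSet Δ) Ξ, ?_, ?_⟩, fun Θ hΘ => ?_⟩
  · rw [← faceDual_faceDual hP h0 h₁, ← faceDual_faceDual hP h0 h₂]
    exact faceDual_anti h
  · simpa only [hdd] using isProperFace_faceDual hD h0' hΞ
  · simpa only [hdd] using faceDual_faceDual hD h0' hΞ
  · rw [direction_affineSpan, direction_affineSpan]
    exact finrank_vectorSpan_add_finrank_vectorSpan_faceDual hP h0 hΘ
end

section
/- Let a, b, c ∈ ℤ² be affinely independent points such that the only lattice points of the triangle conv{a, b, c} are its vertices, i.e. conv{a, b, c} ∩ ℤ² = {a, b, c}. Then the triangle is unimodular: |det(b - a, c - a)| = 1 (equivalently, b - a and c - a form a ℤ-basis of ℤ²). -/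
open Finset

/-- An affinely independent triple of points of `ℤ²` spans a nonzero determinant. -/
theorem det_ne_zero_of_affineIndependent (a b c : Fin 2 → ℤ)
    (hind : AffineIndependent ℝ
      ![(fun i => (a i : ℝ)), (fun i => (b i : ℝ)), (fun i => (c i : ℝ))]) :
    (b 0 - a 0) * (c 1 - a 1) - (b 1 - a 1) * (c 0 - a 0) ≠ 0 := by
  intro hdet
  have hdetR : ((b 0 : ℝ) - a 0) * (c 1 - a 1) - (b 1 - a 1) * (c 0 - a 0) = 0 := by
    exact_mod_cast hdet
  have key : ∀ s t : ℝ, (∀ i, s * ((b i : ℝ) - a i) + t * ((c i : ℝ) - a i) = 0) →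
      s = 0 ∧ t = 0 := by
    intro s t h
    rw [affineIndependent_iff] at hind
    have hw := hind Finset.univ ![-s - t, s, t] (by
      simp only [Fin.sum_univ_three, Matrix.cons_val]
      ring) (by
      ext i
      simp only [Fin.sum_univ_three, Matrix.cons_val, Pi.add_apply, Pi.smul_apply, smul_eq_mul,
        Pi.zero_apply]
      linear_combination h i)
    exact ⟨by simpa using hw 1 (Finset.mem_univ _), by simpa using hw 2 (Finset.mem_univ _)⟩
  have hdep : ∀ j, (c j : ℝ) - a j = 0 ∧ -((b j : ℝ) - a j) = 0 := by
    intro j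
    apply key
    intro i
    fin_cases i <;> fin_cases j <;> simp only [Fin.zero_eta, Fin.mk_one] <;>
      first | ring1 | linear_combination hdetR | linear_combination -hdetR
  refine one_ne_zero (key 1 0 fun i => ?_).1
  linear_combination -(hdep i).2

/-- A positively oriented integral triangle with vertices `0`, `(u₀, u₁)`, `(v₀, v₁)` which
contains no integral points except its vertices has determinant one. -/
theorem det_eq_one_of_empty_triangle (u₀ u₁ v₀ v₁ : ℤ) (hpos : 0 < u₀ * v₁ - u₁ * v₀)
    (h : ∀ x y : ℤ, 0 ≤ x * v₁ - y * v₀ → 0 ≤ u₀ * y - u₁ * x →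
      (x * v₁ - y * v₀) + (u₀ * y - u₁ * x) ≤ u₀ * v₁ - u₁ * v₀ →
      (x = 0 ∧ y = 0) ∨ (x = u₀ ∧ y = u₁) ∨ (x = v₀ ∧ y = v₁)) :
    u₀ * v₁ - u₁ * v₀ = 1 := by
  obtain ⟨D, hD⟩ : ∃ D, D = u₀ * v₁ - u₁ * v₀ := ⟨_, rfl⟩
  rw [← hD] at h hpos ⊢
  have small : ∀ x y : ℤ, 0 ≤ x * v₁ - y * v₀ → 0 ≤ u₀ * y - u₁ * x →
      x * v₁ - y * v₀ < D → u₀ * y - u₁ * x < D →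
      (x * v₁ - y * v₀) + (u₀ * y - u₁ * x) ≤ D → x = 0 ∧ y = 0 := by
    intro x y hs ht hsD htD hst
    rcases h x y hs ht hst with h0 | ⟨rfl, rfl⟩ | ⟨rfl, rfl⟩
    · exact h0
    · exact absurd hsD (by rw [hD]; exact lt_irrefl _)
    · exact absurd htD (by rw [hD]; linarith)
  have hdvd : ∀ x y : ℤ, D ∣ x * v₁ - y * v₀ ∧ D ∣ u₀ * y - u₁ * x := by
    intro x y
    obtain ⟨q, hq⟩ : ∃ q, q = (x * v₁ - y * v₀) / D := ⟨_, rfl⟩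
    obtain ⟨r, hr⟩ : ∃ r, r = (u₀ * y - u₁ * x) / D := ⟨_, rfl⟩
    obtain ⟨x', hx'⟩ : ∃ x', x' = x - q * u₀ - r * v₀ := ⟨_, rfl⟩
    obtain ⟨y', hy'⟩ : ∃ y', y' = y - q * u₁ - r * v₁ := ⟨_, rfl⟩
    have es : x' * v₁ - y' * v₀ = (x * v₁ - y * v₀) % D := by
      rw [Int.emod_def, ← hq, hx', hy', hD]; ring
    have et : u₀ * y' - u₁ * x' = (u₀ * y - u₁ * x) % D := by
      rw [Int.emod_def, ← hr, hx', hy', hD]; ring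
    have hs := Int.emod_nonneg (x * v₁ - y * v₀) hpos.ne'
    have ht := Int.emod_nonneg (u₀ * y - u₁ * x) hpos.ne'
    have hsD := Int.emod_lt_of_pos (x * v₁ - y * v₀) hpos
    have htD := Int.emod_lt_of_pos (u₀ * y - u₁ * x) hpos
    rw [← es] at hs hsD
    rw [← et] at ht htD
    obtain ⟨hx0, hy0⟩ : x' = 0 ∧ y' = 0 := by
      by_cases hst : (x' * v₁ - y' * v₀) + (u₀ * y' - u₁ * x') ≤ D
      · exact small x' y' hs ht hsD htD hst
      · have e₁ : (u₀ + v₀ - x') * v₁ - (u₁ + v₁ - y') * v₀ = D - (x' * v₁ - y' * v₀) := by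
          rw [hD]; ring
        have e₂ : u₀ * (u₁ + v₁ - y') - u₁ * (u₀ + v₀ - x') = D - (u₀ * y' - u₁ * x') := by
          rw [hD]; ring
        have h0 := small (u₀ + v₀ - x') (u₁ + v₁ - y') (by linarith) (by linarith)
          (by linarith) (by linarith) (by linarith)
        rw [h0.1, h0.2] at e₁
        linarith
    rw [hx0, hy0] at es et
    exact ⟨Int.dvd_of_emod_eq_zero (by rw [← es]; ring),
      Int.dvd_of_emod_eq_zero (by rw [← et]; ring)⟩
  obtain ⟨⟨p, hp⟩, ⟨q, hq⟩⟩ := hdvd 1 0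
  obtain ⟨⟨r, hr⟩, ⟨s, hs⟩⟩ := hdvd 0 1
  have hunit : D * (p * s - q * r) = 1 := by
    apply mul_left_cancel₀ hpos.ne'
    linear_combination -hD - (D * s) * hp - v₁ * hs + (D * r) * hq - u₁ * hr
  exact Int.eq_one_of_mul_eq_one_right hpos.le hunit

/-- A positively oriented elementary lattice triangle has determinant one. -/
theorem det_eq_one_of_elementary_of_pos (a b c : Fin 2 → ℤ)
    (hpos : 0 < (b 0 - a 0) * (c 1 - a 1) - (b 1 - a 1) * (c 0 - a 0))
    (hlat : convexHull ℝ
        {(fun i => (a i : ℝ)), (fun i => (b i : ℝ)), (fun i => (c i : ℝ))} ∩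
        {x : Fin 2 → ℝ | IsLatticePoint x} ⊆
        {(fun i => (a i : ℝ)), (fun i => (b i : ℝ)), (fun i => (c i : ℝ))}) :
    (b 0 - a 0) * (c 1 - a 1) - (b 1 - a 1) * (c 0 - a 0) = 1 := by
  apply det_eq_one_of_empty_triangle _ _ _ _ hpos
  intro x y hs ht hst
  have hposR : (0 : ℝ) < ((b 0 : ℝ) - a 0) * (c 1 - a 1) - (b 1 - a 1) * (c 0 - a 0) := by
    exact_mod_cast hpos
  have hsR : (0 : ℝ) ≤ (x : ℝ) * (c 1 - a 1) - y * (c 0 - a 0) := by exact_mod_cast hs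
  have htR : (0 : ℝ) ≤ ((b 0 : ℝ) - a 0) * y - (b 1 - a 1) * x := by exact_mod_cast ht
  have hstR : ((x : ℝ) * (c 1 - a 1) - y * (c 0 - a 0)) +
      (((b 0 : ℝ) - a 0) * y - (b 1 - a 1) * x) ≤
      ((b 0 : ℝ) - a 0) * (c 1 - a 1) - (b 1 - a 1) * (c 0 - a 0) := by exact_mod_cast hst
  obtain ⟨D, hD⟩ : ∃ D : ℝ, D = ((b 0 : ℝ) - a 0) * (c 1 - a 1) - (b 1 - a 1) * (c 0 - a 0) :=
    ⟨_, rfl⟩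
  obtain ⟨s, es⟩ : ∃ s : ℝ, s = (x : ℝ) * (c 1 - a 1) - y * (c 0 - a 0) := ⟨_, rfl⟩
  obtain ⟨t, et⟩ : ∃ t : ℝ, t = ((b 0 : ℝ) - a 0) * y - (b 1 - a 1) * x := ⟨_, rfl⟩
  rw [← es] at hsR hstR
  rw [← et] at htR hstR
  rw [← hD] at hposR hstR
  have hmem : (fun i => ((![a 0 + x, a 1 + y] i : ℤ) : ℝ)) ∈ convexHull ℝ
      {(fun i => (a i : ℝ)), (fun i => (b i : ℝ)), (fun i => (c i : ℝ))} := by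
    have hcomb := (convex_convexHull ℝ
        {(fun i => (a i : ℝ)), (fun i => (b i : ℝ)), (fun i => (c i : ℝ))}).sum_mem
      (t := Finset.univ) (w := ![(D - s - t) / D, s / D, t / D])
      (z := ![(fun i => (a i : ℝ)), (fun i => (b i : ℝ)), (fun i => (c i : ℝ))])
      (by
        intro i _
        fin_cases i
        · exact div_nonneg (by linarith) hposR.le
        · exact div_nonneg hsR hposR.le
        · exact div_nonneg htR hposR.le)
      (by
        simp only [Fin.sum_univ_three, Matrix.cons_val]
        field_simp
        ring)
      (by
        intro i _
        apply subset_convexHull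
        fin_cases i <;> simp)
    convert hcomb using 1
    ext i
    simp only [Fin.sum_univ_three, Matrix.cons_val, Pi.add_apply, Pi.smul_apply, smul_eq_mul]
    field_simp
    fin_cases i
    · simp only [Fin.zero_eta, Matrix.cons_val_zero, Int.cast_add]
      rw [es, et, hD]; ring
    · simp only [Fin.mk_one, Matrix.cons_val_one, Matrix.cons_val_zero, Int.cast_add]
      rw [es, et, hD]; ring
  have hvert := hlat ⟨hmem, fun i => ⟨_, rfl⟩⟩
  simp only [Set.mem_insert_iff, Set.mem_singleton_iff, funext_iff, Fin.forall_fin_two,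
    Int.cast_inj, Matrix.cons_val_zero, Matrix.cons_val_one] at hvert
  omega

/-- An elementary lattice triangle is unimodular: if the only lattice points of
`conv{a, b, c}` are its three (affinely independent) vertices, then
`|det(b - a, c - a)| = 1`. -/
theorem elementary_lattice_triangle_is_unimodular
    (a b c : Fin 2 → ℤ)
    (hind : AffineIndependent ℝ
      ![(fun i => (a i : ℝ)), (fun i => (b i : ℝ)), (fun i => (c i : ℝ))])
    (hlat : convexHull ℝ
        {(fun i => (a i : ℝ)), (fun i => (b i : ℝ)), (fun i => (c i : ℝ))} ∩
        {x : Fin 2 → ℝ | IsLatticePoint x} =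
        {(fun i => (a i : ℝ)), (fun i => (b i : ℝ)), (fun i => (c i : ℝ))}) :
    ((b 0 - a 0) * (c 1 - a 1) - (b 1 - a 1) * (c 0 - a 0)).natAbs = 1 := by
  have hne := det_ne_zero_of_affineIndependent a b c hind
  rcases lt_or_gt_of_ne hne with hneg | hpos
  · have hswap := det_eq_one_of_elementary_of_pos a c b (by linarith)
      (by rw [Set.pair_comm]; exact hlat.subset)
    have : (b 0 - a 0) * (c 1 - a 1) - (b 1 - a 1) * (c 0 - a 0) = -1 := by linarith
    rw [this]; rfl
  · rw [det_eq_one_of_elementary_of_pos a b c hpos hlat.subset]; rfl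
end

section
/- Let Δ₁, Δ₂ ⊆ ℝⁿ be reflexive polytopes and suppose there exist finite morphisms in both directions: group homomorphisms φ₁ : ℤⁿ → ℤⁿ and φ₂ : ℤⁿ → ℤⁿ whose ℝ-linear extensions satisfy φ₁(Δ₁) = Δ₂ and φ₂(Δ₂) = Δ₁. Then φ₁ and φ₂ are group automorphisms of ℤⁿ (unimodular isomorphisms). -/
open Finset

/-- The `ℝ`-linear extension of a group homomorphism `φ : ℤⁿ → ℤⁿ`. -/
def extHom {n : ℕ} (φ : (Fin n → ℤ) →+ (Fin n → ℤ)) (x : Fin n → ℝ) : Fin n → ℝ :=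
  fun i => ∑ j, (φ (Pi.single j 1) i : ℝ) * x j

open MeasureTheory

theorem IsReflexive.volume_ne_zero {n : ℕ} {Δ : Set (Fin n → ℝ)} (h : IsReflexive Δ) :
    volume Δ ≠ 0 :=
  (Measure.measure_pos_of_mem_nhds volume (mem_interior_iff_mem_nhds.mp h.2.1)).ne'

theorem IsReflexive.volume_ne_top {n : ℕ} {Δ : Set (Fin n → ℝ)} (h : IsReflexive Δ) :
    volume Δ ≠ ⊤ := by
  obtain ⟨⟨V, -, rfl⟩, -⟩ := h
  exact V.finite_toSet.isCompact_convexHull (𝕜 := ℝ) |>.measure_ne_top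

/-- The integer determinant of an endomorphism of `ℤⁿ`. -/
noncomputable def latticeDet {n : ℕ} (φ : (Fin n → ℤ) →+ (Fin n → ℤ)) : ℤ :=
  (LinearMap.toMatrix' φ.toIntLinearMap).det

theorem extHom_eq_toLin' {n : ℕ} (φ : (Fin n → ℤ) →+ (Fin n → ℤ)) :
    extHom φ =
      Matrix.toLin' ((LinearMap.toMatrix' φ.toIntLinearMap).map (Int.cast : ℤ → ℝ)) := by
  ext x i
  simp [extHom, Matrix.mulVec, dotProduct, LinearMap.toMatrix'_apply]

theorem volume_image_extHom {n : ℕ} (φ : (Fin n → ℤ) →+ (Fin n → ℤ)) (s : Set (Fin n → ℝ)) :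
    volume (extHom φ '' s) = ENNReal.ofReal |(latticeDet φ : ℝ)| * volume s := by
  rw [extHom_eq_toLin', Measure.addHaar_image_linearMap, LinearMap.det_toLin', latticeDet,
    Int.cast_det]

theorem bijective_of_isUnit_latticeDet {n : ℕ} {φ : (Fin n → ℤ) →+ (Fin n → ℤ)}
    (h : IsUnit (latticeDet φ)) : Function.Bijective φ := by
  rw [latticeDet, LinearMap.det_toMatrix'] at h
  have hb := (LinearMap.equivOfIsUnitDet h).bijective
  rwa [← LinearEquiv.coe_coe, LinearMap.coe_equivOfIsUnitDet] at hb

/-- If two reflexive polytopes admit finite morphisms in both directions, then both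
morphisms are automorphisms of the lattice `ℤⁿ`. -/
theorem finite_morphisms_both_directions_are_isomorphisms
    (n : ℕ) (hn : 1 ≤ n) (Δ₁ Δ₂ : Set (Fin n → ℝ))
    (hΔ₁ : IsReflexive Δ₁) (hΔ₂ : IsReflexive Δ₂)
    (φ₁ φ₂ : (Fin n → ℤ) →+ (Fin n → ℤ))
    (hφ₁ : extHom φ₁ '' Δ₁ = Δ₂) (hφ₂ : extHom φ₂ '' Δ₂ = Δ₁) :
    Function.Bijective φ₁ ∧ Function.Bijective φ₂ := by
  have hv : ENNReal.ofReal |((latticeDet φ₂ * latticeDet φ₁ : ℤ) : ℝ)| * volume Δ₁ =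
      1 * volume Δ₁ := by
    rw [one_mul, Int.cast_mul, abs_mul, ENNReal.ofReal_mul (abs_nonneg _), mul_assoc,
      ← volume_image_extHom, hφ₁, ← volume_image_extHom, hφ₂]
  have habs : |((latticeDet φ₂ * latticeDet φ₁ : ℤ) : ℝ)| = 1 :=
    ENNReal.ofReal_eq_one.mp
      ((ENNReal.mul_left_inj hΔ₁.volume_ne_zero hΔ₁.volume_ne_top).mp hv)
  have hunit : IsUnit (latticeDet φ₂ * latticeDet φ₁) :=
    Int.isUnit_iff_abs_eq.mpr (mod_cast habs)
  obtain ⟨h₂, h₁⟩ := IsUnit.mul_iff.mp hunit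
  exact ⟨bijective_of_isUnit_latticeDet h₁, bijective_of_isUnit_latticeDet h₂⟩
end

section
/- Let Δ = conv{p₀, …, p_n} ⊆ ℝⁿ be a reflexive simplex and l₀, …, l_n ∈ ℤⁿ points with Δ* = conv{l₀, …, l_n} and ⟨p_i, l_j⟩ = -1 for all i ≠ j. Then each diagonal entry b_{ii} = ⟨p_i, l_i⟩ is a positive integer and ∑_{i=0}^{n} 1/(b_{ii} + 1) = 1. -/
open Finset

/-- The origin, if interior to a full-dimensional simplex, is a convex combination of the
vertices with positive weights. -/
theorem exists_pos_weights_of_zero_mem_interior {n : ℕ} {p : Fin (n + 1) → (Fin n → ℝ)}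
    (hind : AffineIndependent ℝ p)
    (h0 : (0 : Fin n → ℝ) ∈ interior (convexHull ℝ (Set.range p))) :
    ∃ w : Fin (n + 1) → ℝ, (∀ i, 0 < w i) ∧ ∑ i, w i = 1 ∧ ∑ i, w i • p i = 0 := by
  have htop : affineSpan ℝ (Set.range p) = ⊤ := by
    rw [hind.affineSpan_eq_top_iff_card_eq_finrank_add_one]
    simp
  let b : AffineBasis (Fin (n + 1)) ℝ (Fin n → ℝ) := ⟨p, hind, htop⟩
  have hb : (0 : Fin n → ℝ) ∈ interior (convexHull ℝ (Set.range b)) := h0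
  rw [b.interior_convexHull] at hb
  exact ⟨fun i => b.coord i 0, hb, b.sum_coord_apply_eq_one 0,
    b.linear_combination_coord_eq_self 0⟩

theorem IsLatticePoint.exists_int_sum_mul {n : ℕ} {x y : Fin n → ℝ}
    (hx : IsLatticePoint x) (hy : IsLatticePoint y) : ∃ m : ℤ, ∑ k, x k * y k = m := by
  choose a ha using hx
  choose b hb using hy
  exact ⟨∑ k, a k * b k, by simp [ha, hb]⟩

/-- For a reflexive simplex, the diagonal entries `b_{ii} = ⟨p_i, l_i⟩` of its matrix are
positive integers satisfying `∑ 1/(b_{ii} + 1) = 1`. -/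
theorem diagonal_of_reflexive_simplex
    (n : ℕ) (hn : 1 ≤ n) (p l : Fin (n + 1) → (Fin n → ℝ))
    (hp : ∀ i, IsLatticePoint (p i)) (hl : ∀ i, IsLatticePoint (l i))
    (hind : AffineIndependent ℝ p)
    (hΔ : IsReflexive (convexHull ℝ (Set.range p)))
    (hdual : dualSet (convexHull ℝ (Set.range p)) = convexHull ℝ (Set.range l))
    (hoff : ∀ i j, i ≠ j → ∑ k, p i k * l j k = -1) :
    (∀ i, ∃ m : ℤ, 0 < m ∧ ∑ k, p i k * l i k = (m : ℝ)) ∧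
    ∑ i, (1 : ℝ) / ((∑ k, p i k * l i k) + 1) = 1 := by
  obtain ⟨w, hpos, hsum, hzero⟩ := exists_pos_weights_of_zero_mem_interior hind hΔ.2.1
  have hw (j : Fin (n + 1)) : w j * ((∑ k, p j k * l j k) + 1) = 1 := by
    have hpair : ∑ i, w i * ∑ k, p i k * l j k = 0 := by
      simp_rw [Finset.mul_sum, ← mul_assoc]
      rw [Finset.sum_comm]
      refine Finset.sum_eq_zero fun k _ => ?_
      have hk := congrFun hzero k
      simp only [Finset.sum_apply, Pi.smul_apply, smul_eq_mul, Pi.zero_apply] at hk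
      rw [← Finset.sum_mul, hk, zero_mul]
    have hoff' : ∑ i ∈ univ.erase j, w i * ∑ k, p i k * l j k = -∑ i ∈ univ.erase j, w i := by
      rw [← Finset.sum_neg_distrib]
      refine Finset.sum_congr rfl fun i hi => ?_
      rw [hoff i j (Finset.ne_of_mem_erase hi), mul_neg_one]
    rw [← Finset.add_sum_erase _ _ (Finset.mem_univ j)] at hpair hsum
    linarith
  have hlt (j : Fin (n + 1)) : w j < 1 := by
    have : Nontrivial (Fin (n + 1)) := Fin.nontrivial_iff_two_le.2 (by omega)
    obtain ⟨i, hij⟩ := exists_ne j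
    rw [← hsum]
    exact Finset.single_lt_sum hij (mem_univ j) (mem_univ i) (hpos i) fun k _ _ => (hpos k).le
  refine ⟨fun i => ?_, ?_⟩
  · obtain ⟨m, hm⟩ := (hp i).exists_int_sum_mul (hl i)
    refine ⟨m, ?_, hm⟩
    have h := hw i
    rw [hm] at h
    have : (0 : ℝ) < m := by
      by_contra! hneg
      nlinarith [hpos i, hlt i]
    exact_mod_cast this
  · exact (Finset.sum_congr rfl fun i _ =>
      (eq_one_div_of_mul_eq_one_left (hw i)).symm).trans hsum
end

section
/- Let Δ = conv{p₀, …, p_n} ⊆ ℝⁿ be a reflexive simplex and l₀, …, l_n ∈ ℤⁿ points with Δ* = conv{l₀, …, l_n} and ⟨p_i, l_j⟩ = -1 for all i ≠ j; put b_{ij} = ⟨p_i, l_j⟩, d = lcm_{0≤j≤n}(b_{jj} + 1), and w_i = d/(b_{ii} + 1). Then each w_i is a positive integer, gcd(w₀, …, w_n) = 1, the vector w = (w₀, …, w_n) solves the homogeneous system B·w = 0 (i.e. ∑_{j=0}^n b_{ij} w_j = 0 for every i), and ∑_{i=0}^n w_i p_i = 0; thus w is the vector of weights of Δ. -/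
open Finset

/-- A point in the interior of a full-dimensional simplex is a convex combination of the vertices
with positive coefficients. -/
theorem exists_pos_convexCombination_of_mem_interior {n : ℕ} {p : Fin (n + 1) → (Fin n → ℝ)}
    (hind : AffineIndependent ℝ p) {x : Fin n → ℝ}
    (hx : x ∈ interior (convexHull ℝ (Set.range p))) :
    ∃ a : Fin (n + 1) → ℝ, (∀ i, 0 < a i) ∧ ∑ i, a i = 1 ∧ ∑ i, a i • p i = x := by
  have htop : affineSpan ℝ (Set.range p) = ⊤ :=
    hind.affineSpan_eq_top_iff_card_eq_finrank_add_one.2 (by simp)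
  let B : AffineBasis (Fin (n + 1)) ℝ (Fin n → ℝ) := ⟨p, hind, htop⟩
  have hxB : x ∈ interior (convexHull ℝ (Set.range B)) := hx
  rw [B.interior_convexHull] at hxB
  exact ⟨fun i => B.coord i x, hxB, B.sum_coord_apply_eq_one x, B.linear_combination_coord_eq_self x⟩

/-- The quotients of the least common multiple of nonzero integers by these integers are coprime. -/
theorem gcd_lcm_div_eq_one {ι : Type*} (s : Finset ι) (hs : s.Nonempty) (c : ι → ℤ)
    (hc : ∀ i ∈ s, c i ≠ 0) : s.gcd (fun i => s.lcm c / c i) = 1 := by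
  set d := s.lcm c with hd
  set g := s.gcd (fun i => d / c i) with hg
  have hd0 : d ≠ 0 := by
    rw [hd, Ne, Finset.lcm_eq_zero_iff]
    rintro ⟨i, hi, h0⟩
    exact hc i hi h0
  have hmul : ∀ i ∈ s, d / c i * c i = d := fun i hi => Int.ediv_mul_cancel (Finset.dvd_lcm hi)
  have hgd : ∀ i ∈ s, g ∣ d / c i := fun i hi => Finset.gcd_dvd hi
  obtain ⟨k, hk⟩ := hs
  obtain ⟨e, he⟩ : g ∣ d := (hgd k hk).trans ⟨c k, (hmul k hk).symm⟩
  have hg0 : g ≠ 0 := fun h => hd0 (by rw [he, h, zero_mul])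
  have hde : d ∣ e := by
    refine Finset.lcm_dvd fun i hi => ?_
    obtain ⟨v, hv⟩ := hgd i hi
    refine ⟨v, mul_left_cancel₀ hg0 ?_⟩
    rw [← he, ← hmul i hi, hv]
    ring
  have hunit : IsUnit g := by
    obtain ⟨f, hf⟩ := hde
    refine IsUnit.of_mul_eq_one f (mul_left_cancel₀ hd0 ?_)
    calc d * (g * f) = g * (d * f) := by ring
      _ = d * 1 := by rw [← hf, ← he, mul_one]
  have hnorm : normalize g = g := Finset.normalize_gcd
  rw [← hnorm, normalize_eq_one.2 hunit]

/-- The weights `w_i = lcm_j(b_jj + 1)/(b_ii + 1)` of a reflexive simplex are positive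
integers with gcd `1`; they give the primitive integral solution of the homogeneous
system `B·w = 0`, and `∑ w_i p_i = 0`. -/
theorem weights_of_reflexive_simplex
    (n : ℕ) (hn : 1 ≤ n) (p l : Fin (n + 1) → (Fin n → ℝ))
    (hp : ∀ i, IsLatticePoint (p i)) (hl : ∀ i, IsLatticePoint (l i))
    (hind : AffineIndependent ℝ p)
    (hΔ : IsReflexive (convexHull ℝ (Set.range p)))
    (hdual : dualSet (convexHull ℝ (Set.range p)) = convexHull ℝ (Set.range l))
    (b : Matrix (Fin (n + 1)) (Fin (n + 1)) ℤ)
    (hb : ∀ i j, (b i j : ℝ) = ∑ k, p i k * l j k)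
    (hoff : ∀ i j, i ≠ j → b i j = -1) :
    let d : ℤ := Finset.univ.lcm (fun j => b j j + 1)
    let w : Fin (n + 1) → ℤ := fun i => d / (b i i + 1)
    (∀ i, 0 < w i) ∧ Finset.univ.gcd w = 1 ∧
      (∀ i, ∑ j, b i j * w j = 0) ∧
      ∑ i, (w i : ℝ) • p i = 0 := by
  intro d w
  obtain ⟨a, ha_pos, ha_sum, ha_zero⟩ := exists_pos_convexCombination_of_mem_interior hind hΔ.2.1
  have ha_pair : ∀ j, ∑ i, a i * (b i j : ℝ) = 0 := fun j => by
    calc ∑ i, a i * (b i j : ℝ) = ∑ k, (∑ i, a i • p i) k * l j k := by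
          simp_rw [hb, Finset.sum_apply, Pi.smul_apply, smul_eq_mul, Finset.sum_mul,
            Finset.mul_sum, mul_assoc]
          exact Finset.sum_comm
      _ = 0 := by rw [ha_zero]; simp
  have hb_split : ∀ i j, b i j = (if i = j then b j j + 1 else 0) - 1 := fun i j => by
    split_ifs with h
    · subst h; ring
    · rw [hoff i j h]; ring
  have ha_mul : ∀ j, a j * ((b j j + 1 : ℤ) : ℝ) = 1 := fun j => by
    have h := ha_pair j
    rw [Finset.sum_congr rfl fun i _ => by rw [hb_split i j]] at h
    push_cast [mul_sub, Finset.sum_sub_distrib] at h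
    simp only [mul_ite, mul_zero, mul_one, Finset.sum_ite_eq', Finset.mem_univ, if_true,
      ha_sum] at h
    push_cast
    linarith
  have hc_pos : ∀ j, 0 < b j j + 1 := fun j => by
    have h : (0 : ℝ) < a j * ((b j j + 1 : ℤ) : ℝ) := by rw [ha_mul j]; exact one_pos
    exact_mod_cast (pos_iff_pos_of_mul_pos h).1 (ha_pos j)
  have hd_pos : 0 < d := by
    have h0 : d ≠ 0 := by
      simp only [d, Ne, Finset.lcm_eq_zero_iff]
      rintro ⟨i, -, h⟩
      exact (hc_pos i).ne' h
    have hnorm : normalize d = d := Finset.normalize_lcm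
    rw [← Int.abs_eq_normalize] at hnorm
    exact lt_of_le_of_ne (abs_eq_self.1 hnorm) h0.symm
  have hw_mul : ∀ i, w i * (b i i + 1) = d := fun i =>
    Int.ediv_mul_cancel (Finset.dvd_lcm (f := fun j => b j j + 1) (Finset.mem_univ i))
  have hw_eq : ∀ i, (w i : ℝ) = d * a i := fun i => by
    have h : (w i : ℝ) * ((b i i + 1 : ℤ) : ℝ) = d := by exact_mod_cast hw_mul i
    rw [← h, mul_assoc, mul_comm _ (a i), ha_mul, mul_one]
  have hw_sum : ∑ i, w i = d := by
    have h : ∑ i, (w i : ℝ) = d := by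
      simp_rw [hw_eq, ← Finset.mul_sum, ha_sum, mul_one]
    exact_mod_cast h
  refine ⟨fun i => ?_, ?_, fun i => ?_, ?_⟩
  · exact pos_of_mul_pos_left (by rw [hw_mul i]; exact hd_pos) (hc_pos i).le
  · exact gcd_lcm_div_eq_one _ Finset.univ_nonempty _ fun i _ => (hc_pos i).ne'
  · simp_rw [hb_split i, sub_mul, Finset.sum_sub_distrib, ite_mul, zero_mul, one_mul, hw_sum]
    simp only [Finset.sum_ite_eq, Finset.mem_univ, if_true]
    rw [mul_comm, hw_mul, sub_self]
  · simp_rw [hw_eq, mul_smul, ← Finset.smul_sum, ha_zero, smul_zero]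
end

section
/- Let Δ = conv{p₀, …, p_n} ⊆ ℝⁿ be a reflexive simplex with weights w₀, …, w_n, and let l₀, …, l_n ∈ ℤⁿ be points with Δ* = conv{l₀, …, l_n} and ⟨p_i, l_j⟩ = -1 for all i ≠ j. Define ι : ℝⁿ → ℝ^{n+1} by ι(m) = (⟨m, l₀⟩, …, ⟨m, l_n⟩), and set M(w) = {x ∈ ℤ^{n+1} : ∑_{i=0}^n w_i x_i = 0} and Δ(w) = {x ∈ ℝ^{n+1} : ∑_{i=0}^n w_i x_i = 0 and x_i ≥ -1 for all i}. Then ι is an injective linear map with ι(ℤⁿ) ⊆ M(w), ι(Δ) = Δ(w), and Δ(w) = conv{ι(p₀), …, ι(p_n)}. -/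
open Finset

/-- The pairing of a weighted sum of the `p i` with a dual vertex. -/
theorem pairing_linear_combination {n : ℕ} {p l : Fin (n + 1) → (Fin n → ℝ)}
    {w : Fin (n + 1) → ℝ} (hwpos : ∀ i, 0 < w i)
    (hoff : ∀ i j, i ≠ j → ∑ k, p i k * l j k = -1) (hwrel : ∑ i, w i • p i = 0)
    (a : Fin (n + 1) → ℝ) (j : Fin (n + 1)) :
    ∑ k, (∑ i, a i • p i) k * l j k = -(∑ i, a i) + a j * (∑ i, w i) / w j := by
  have expand (c : Fin (n + 1) → ℝ) :
      ∑ k, (∑ i, c i • p i) k * l j k =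
        -(∑ i, c i) + c j * (∑ k, p j k * l j k + 1) := by
    have h1 : ∑ k, (∑ i, c i • p i) k * l j k = ∑ i, c i * ∑ k, p i k * l j k := by
      simp only [Finset.sum_apply, Pi.smul_apply, smul_eq_mul, Finset.sum_mul, Finset.mul_sum]
      rw [Finset.sum_comm]
      simp only [mul_assoc]
    have h2 (i : Fin (n + 1)) : c i * ∑ k, p i k * l j k =
        -c i + if i = j then c i * (∑ k, p i k * l j k + 1) else 0 := by
      split_ifs with h
      · ring
      · rw [hoff i j h]; ring
    rw [h1, Finset.sum_congr rfl fun i _ => h2 i, Finset.sum_add_distrib]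
    simp
  have hw := expand w
  rw [hwrel] at hw
  simp only [Pi.zero_apply, zero_mul, Finset.sum_const_zero] at hw
  have hdiag : ∑ k, p j k * l j k + 1 = (∑ i, w i) / w j := by
    rw [eq_div_iff (hwpos j).ne']
    linarith
  rw [expand, hdiag, mul_div_assoc]

/-- The embedding `ι(m) = (⟨m, l₀⟩, …, ⟨m, l_n⟩)` of a reflexive simplex with weights `w`
into the weighted hyperplane: `ι` is an injective linear map sending `ℤⁿ` into
`M(w)`, and `ι(Δ) = Δ(w) = conv{ι(p₀), …, ι(p_n)}`. -/
theorem reflexive_simplex_embeds_into_weighted_model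
    (n : ℕ) (hn : 1 ≤ n) (p l : Fin (n + 1) → (Fin n → ℝ))
    (hp : ∀ i, IsLatticePoint (p i)) (hl : ∀ i, IsLatticePoint (l i))
    (hind : AffineIndependent ℝ p)
    (hΔ : IsReflexive (convexHull ℝ (Set.range p)))
    (hdual : dualSet (convexHull ℝ (Set.range p)) = convexHull ℝ (Set.range l))
    (hoff : ∀ i j, i ≠ j → ∑ k, p i k * l j k = -1)
    (w : Fin (n + 1) → ℤ) (hwpos : ∀ i, 0 < w i)
    (hwgcd : Finset.univ.gcd w = 1)
    (hwrel : ∑ i, (w i : ℝ) • p i = 0) :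
    let ι : (Fin n → ℝ) → (Fin (n + 1) → ℝ) := fun m j => ∑ k, m k * l j k
    (Function.Injective ι ∧ IsLinearMap ℝ ι) ∧
    (∀ m : Fin n → ℝ, IsLatticePoint m →
      (∀ j, ∃ z : ℤ, ι m j = (z : ℝ)) ∧ ∑ i, (w i : ℝ) * ι m i = 0) ∧
    ι '' (convexHull ℝ (Set.range p)) =
      {x : Fin (n + 1) → ℝ | ∑ i, (w i : ℝ) * x i = 0 ∧ ∀ i, -1 ≤ x i} ∧
    {x : Fin (n + 1) → ℝ | ∑ i, (w i : ℝ) * x i = 0 ∧ ∀ i, -1 ≤ x i} =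
      convexHull ℝ (Set.range fun i => ι (p i)) := by
  intro ι
  have hw (i) : (0 : ℝ) < w i := Int.cast_pos.mpr (hwpos i)
  have hW : (0 : ℝ) < ∑ i, (w i : ℝ) := Finset.sum_pos (fun i _ => hw i) Finset.univ_nonempty
  have key (a : Fin (n + 1) → ℝ) (j) :
      ι (∑ i, a i • p i) j = -(∑ i, a i) + a j * (∑ i, (w i : ℝ)) / w j :=
    pairing_linear_combination hw hoff hwrel a j
  let b : AffineBasis (Fin (n + 1)) ℝ (Fin n → ℝ) :=
    ⟨p, hind, hind.affineSpan_eq_top_iff_card_eq_finrank_add_one.mpr (by simp)⟩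
  have hsum (m : Fin n → ℝ) : ∑ i, b.coord i m = 1 := b.sum_coord_apply_eq_one m
  have hcomb (m : Fin n → ℝ) : ∑ i, b.coord i m • p i = m :=
    b.linear_combination_coord_eq_self m
  have hcoord (m j) : ι m j = -1 + b.coord j m * (∑ i, (w i : ℝ)) / w j := by
    have h := key (fun i => b.coord i m) j
    rwa [hcomb, hsum] at h
  have hlin : IsLinearMap ℝ ι :=
    { map_add := fun x y => by ext j; simp [ι, add_mul, Finset.sum_add_distrib]
      map_smul := fun c x => by ext j; simp [ι, mul_assoc, Finset.mul_sum] }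
  have hinj : Function.Injective ι := by
    intro x y hxy
    rw [← hcomb x, ← hcomb y]
    refine Finset.sum_congr rfl fun j _ => ?_
    have h := congrFun hxy j
    rw [hcoord, hcoord, add_right_inj, div_left_inj' (hw j).ne', mul_left_inj' hW.ne'] at h
    rw [h]
  have hweight (m : Fin n → ℝ) : ∑ i, (w i : ℝ) * ι m i = 0 := by
    have h (i) : (w i : ℝ) * ι m i = -w i + b.coord i m * ∑ i, (w i : ℝ) := by
      rw [hcoord]
      field_simp [(hw i).ne']
    rw [Finset.sum_congr rfl fun i _ => h i, Finset.sum_add_distrib, ← Finset.sum_mul, hsum]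
    simp
  have himage : ι '' (convexHull ℝ (Set.range p)) =
      {x : Fin (n + 1) → ℝ | ∑ i, (w i : ℝ) * x i = 0 ∧ ∀ i, -1 ≤ x i} := by
    have hhull : convexHull ℝ (Set.range p) = {x | ∀ i, 0 ≤ b.coord i x} :=
      b.convexHull_eq_nonneg_coord
    apply Set.Subset.antisymm
    · rintro _ ⟨m, hm, rfl⟩
      rw [hhull] at hm
      refine ⟨hweight m, fun j => ?_⟩
      rw [hcoord]
      have := div_nonneg (mul_nonneg (hm j) hW.le) (hw j).le
      linarith
    · rintro y ⟨hy, hy1⟩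
      let a : Fin (n + 1) → ℝ := fun i => w i * (y i + 1) / ∑ i, (w i : ℝ)
      have ha0 (i) : 0 ≤ a i :=
        div_nonneg (mul_nonneg (hw i).le (by linarith [hy1 i])) hW.le
      have ha1 : ∑ i, a i = 1 := by
        simp only [a]
        rw [← Finset.sum_div, div_eq_one_iff_eq hW.ne']
        simp [mul_add, Finset.sum_add_distrib, hy]
      refine ⟨∑ i, a i • p i, ?_, ?_⟩
      · exact (convex_convexHull ℝ _).sum_mem (fun i _ => ha0 i) ha1
          fun i _ => subset_convexHull ℝ _ ⟨i, rfl⟩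
      · ext j
        rw [key, ha1]
        simp only [a]
        rw [div_mul_cancel₀ _ hW.ne', mul_div_cancel_left₀ _ (hw j).ne']
        ring
  refine ⟨⟨hinj, hlin⟩, fun m hm => ⟨fun j => ?_, hweight m⟩, himage, ?_⟩
  · choose c hc using hm
    choose d hd using hl j
    exact ⟨∑ k, c k * d k, by simp [ι, hc, hd]⟩
  · rw [← himage, hlin.image_convexHull, ← Set.range_comp]
    rfl
end

section
/- Let Δ = conv{p₀, …, p_n} ⊆ ℝⁿ be a reflexive simplex with weights w₀, …, w_n, and let l₀, …, l_n ∈ ℤⁿ be points with Δ* = conv{l₀, …, l_n} and ⟨p_i, l_j⟩ = -1 for all i ≠ j. Then the dual reflexive simplex Δ* has the same weights as Δ: ∑_{i=0}^n w_i l_i = 0 (and w₀, …, w_n is the unique primitive positive integral relation among l₀, …, l_n). In this sense every reflexive simplex is selfdual. -/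
open Finset

/-- If the pairings `⟨x, l j⟩` are `-1` for all `j ≠ i`, then pairing `x` with a combination of
the `l j` only involves the `i`-th coefficient and the sum of all coefficients. -/
theorem dotProduct_sum_smul_of_eq_neg_one {m ι : Type*} [Fintype m] [Fintype ι]
    (x : m → ℝ) (l : ι → m → ℝ) (i : ι) (h : ∀ j, j ≠ i → x ⬝ᵥ l j = -1) (v : ι → ℝ) :
    x ⬝ᵥ ∑ j, v j • l j = v i * (x ⬝ᵥ l i + 1) - ∑ j, v j := by
  classical
  rw [dotProduct_sum, eq_sub_iff_add_eq, ← Finset.sum_add_distrib,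
    Finset.sum_eq_single_of_mem i (Finset.mem_univ i)]
  · rw [dotProduct_smul, smul_eq_mul]
    ring
  · intro j _ hj
    rw [dotProduct_smul, h j hj, smul_eq_mul]
    ring

/-- A vector orthogonal to `n + 1` affinely independent points of `ℝⁿ` vanishes. -/
theorem AffineIndependent.eq_zero_of_dotProduct_eq_zero {n : ℕ} {p : Fin (n + 1) → (Fin n → ℝ)}
    (hp : AffineIndependent ℝ p) {u : Fin n → ℝ} (hu : ∀ i, p i ⬝ᵥ u = 0) : u = 0 := by
  have htop : affineSpan ℝ (Set.range p) = ⊤ :=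
    hp.affineSpan_eq_top_iff_card_eq_finrank_add_one.2 (by simp)
  let K : Submodule ℝ (Fin n → ℝ) :=
    { carrier := {x | x ⬝ᵥ u = 0}
      zero_mem' := zero_dotProduct u
      add_mem' := fun {a b} (ha : a ⬝ᵥ u = 0) (hb : b ⬝ᵥ u = 0) => by
        simp [add_dotProduct, ha, hb]
      smul_mem' := fun c x (hx : x ⬝ᵥ u = 0) => by simp [smul_dotProduct, hx] }
  have hle : affineSpan ℝ (Set.range p) ≤ K.toAffineSubspace :=
    affineSpan_le.2 (Set.range_subset_iff.2 hu)
  have hmem : u ∈ K.toAffineSubspace := hle (htop ▸ AffineSubspace.mem_top ℝ _ u)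
  exact dotProduct_self_eq_zero.1 hmem

/-- Proportional integer vectors with positive factors and trivial gcd are equal. -/
theorem eq_of_mul_eq_mul_of_gcd_eq_one {ι : Type*} [Fintype ι] {v w : ι → ℤ} {a b : ℤ}
    (ha : 0 < a) (hb : 0 < b) (hv : Finset.univ.gcd v = 1) (hw : Finset.univ.gcd w = 1)
    (h : ∀ i, v i * a = w i * b) : v = w := by
  have hab : a = b := by
    have hgcd : Finset.univ.gcd (fun i => v i * a) = Finset.univ.gcd (fun i => w i * b) := by
      simp only [h]
    rwa [Finset.gcd_mul_right, Finset.gcd_mul_right, hv, hw, one_mul, one_mul,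
      Int.normalize_of_nonneg ha.le, Int.normalize_of_nonneg hb.le] at hgcd
  subst hab
  exact funext fun i => mul_right_cancel₀ ha.ne' (h i)

/-- Every reflexive simplex is selfdual: the dual reflexive simplex `Δ*` has the same
weights, i.e. `∑ w_i l_i = 0` and `w` is the unique primitive positive integral relation
among the vertices `l_i` of `Δ*`. -/
theorem reflexive_simplex_selfdual
    (n : ℕ) (hn : 1 ≤ n) (p l : Fin (n + 1) → (Fin n → ℝ))
    (hp : ∀ i, IsLatticePoint (p i)) (hl : ∀ i, IsLatticePoint (l i))
    (hind : AffineIndependent ℝ p)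
    (hΔ : IsReflexive (convexHull ℝ (Set.range p)))
    (hdual : dualSet (convexHull ℝ (Set.range p)) = convexHull ℝ (Set.range l))
    (hoff : ∀ i j, i ≠ j → ∑ k, p i k * l j k = -1)
    (w : Fin (n + 1) → ℤ) (hwpos : ∀ i, 0 < w i)
    (hwgcd : Finset.univ.gcd w = 1)
    (hwrel : ∑ i, (w i : ℝ) • p i = 0) :
    (∑ i, (w i : ℝ) • l i = 0) ∧
    ∀ w' : Fin (n + 1) → ℤ, (∀ i, 0 < w' i) → Finset.univ.gcd w' = 1 →
      (∑ i, (w' i : ℝ) • l i = 0) → w' = w := by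
  have hw (i : Fin (n + 1)) : (w i : ℝ) * (p i ⬝ᵥ l i + 1) = ∑ j, (w j : ℝ) := by
    have h := dotProduct_sum_smul_of_eq_neg_one (l i) p i
      (fun j hj => (dotProduct_comm _ _).trans (hoff j i hj)) fun j => (w j : ℝ)
    rw [hwrel, dotProduct_zero, dotProduct_comm] at h
    linarith
  have hpair (i : Fin (n + 1)) (v : Fin (n + 1) → ℝ) :=
    dotProduct_sum_smul_of_eq_neg_one (p i) l i (fun j hj => hoff i j hj.symm) v
  refine ⟨hind.eq_zero_of_dotProduct_eq_zero fun i => ?_, fun w' hpos hgcd hrel => ?_⟩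
  · rw [hpair i fun j => (w j : ℝ), hw, sub_self]
  · refine eq_of_mul_eq_mul_of_gcd_eq_one
      (Finset.sum_pos (fun i _ => hwpos i) Finset.univ_nonempty)
      (Finset.sum_pos (fun i _ => hpos i) Finset.univ_nonempty) hgcd hwgcd fun i => ?_
    have h := hpair i fun j => (w' j : ℝ)
    rw [hrel, dotProduct_zero] at h
    have key : (w' i : ℝ) * ∑ j, (w j : ℝ) = w i * ∑ j, (w' j : ℝ) := by
      linear_combination (-(w' i : ℝ)) * hw i - (w i : ℝ) * h
    exact_mod_cast key
end

section
/- The map γ̄ : (∏_{i=0}^n ℤ/d_iℤ)/⟨(1̄, …, 1̄)⟩ → ℤ/dℤ induced by (a₀, …, a_n) ↦ ∑_{i=0}^n w_i a_i mod d is a well-defined surjective group homomorphism, and the quotient group M(w)/M_B(w) is isomorphic to the kernel of γ̄. -/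
open Finset

/-- `M(w) = {x ∈ ℤ^{n+1} : ∑ w_i x_i = 0}` as an additive subgroup of `ℤ^{n+1}`. -/
def Mw (n : ℕ) (w : Fin (n + 1) → ℕ) : AddSubgroup (Fin (n + 1) → ℤ) where
  carrier := {x | ∑ i, (w i : ℤ) * x i = 0}
  zero_mem' := by simp
  add_mem' := by
    intro a b ha hb
    simp only [Set.mem_setOf_eq, Pi.add_apply, mul_add, Finset.sum_add_distrib] at *
    rw [ha, hb, add_zero]
  neg_mem' := by
    intro a ha
    simp only [Set.mem_setOf_eq, Pi.neg_apply, mul_neg, Finset.sum_neg_distrib] at *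
    rw [ha, neg_zero]

/-- `M_B(w) ⊆ ℤ^{n+1}`: the subgroup generated by the vectors
`r_i = d_i·e_i − (1, …, 1)`. -/
def MB (n : ℕ) (d : Fin (n + 1) → ℕ) : AddSubgroup (Fin (n + 1) → ℤ) :=
  AddSubgroup.closure
    (Set.range fun i : Fin (n + 1) => fun j => (if j = i then (d i : ℤ) else 0) - 1)

/-- The homomorphism `ℤ/dᵢℤ → ℤ/Lℤ`, `L = lcm d`, given by multiplication by `L / dᵢ`. -/
def mulWeightHom {ι : Type*} [Fintype ι] (d : ι → ℕ) (i : ι) :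
    ZMod (d i) →+ ZMod (Finset.univ.lcm d) :=
  ZMod.lift (d i) ⟨zmultiplesHom _ ((Finset.univ.lcm d / d i : ℕ) : ZMod (Finset.univ.lcm d)), by
    rw [zmultiplesHom_apply, natCast_zsmul, nsmul_eq_mul, ← Nat.cast_mul,
      Nat.mul_div_cancel' (Finset.dvd_lcm (Finset.mem_univ i)), ZMod.natCast_self]⟩

theorem mulWeightHom_intCast {ι : Type*} [Fintype ι] (d : ι → ℕ) (i : ι) (k : ℤ) :
    mulWeightHom d i k = ((((Finset.univ.lcm d / d i : ℕ) : ℤ) * k : ℤ) :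
      ZMod (Finset.univ.lcm d)) := by
  simp [mulWeightHom, mul_comm, -Int.natCast_ediv]

/-- The homomorphism `∏ ℤ/dᵢℤ → ℤ/Lℤ`, `a ↦ ∑ (L / dᵢ) aᵢ`, where `L = lcm d`. -/
def weightedSumHom {ι : Type*} [Fintype ι] (d : ι → ℕ) :
    (∀ i, ZMod (d i)) →+ ZMod (Finset.univ.lcm d) :=
  ∑ i, (mulWeightHom d i).comp (Pi.evalAddMonoidHom _ i)

theorem weightedSumHom_apply {ι : Type*} [Fintype ι] (d : ι → ℕ) (a : ∀ i, ZMod (d i)) :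
    weightedSumHom d a = ∑ i, mulWeightHom d i (a i) := by
  simp [weightedSumHom]

theorem weightedSumHom_intCast {ι : Type*} [Fintype ι] (d : ι → ℕ) (x : ι → ℤ) :
    weightedSumHom d (fun i => (x i : ZMod (d i))) =
      ((∑ i, ((Finset.univ.lcm d / d i : ℕ) : ℤ) * x i : ℤ) : ZMod (Finset.univ.lcm d)) := by
  simp only [weightedSumHom_apply, mulWeightHom_intCast, Int.cast_sum]

theorem lcm_pos_of_pos {ι : Type*} [Fintype ι] {d : ι → ℕ} (hd : ∀ i, 0 < d i) :
    0 < Finset.univ.lcm d :=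
  Nat.pos_of_ne_zero fun h => by
    obtain ⟨i, -, hi⟩ := Finset.lcm_eq_zero_iff.mp h
    exact (hd i).ne' hi

theorem weightedSumHom_surjective {ι : Type*} [Fintype ι] {d : ι → ℕ} (hd : ∀ i, 0 < d i) :
    Function.Surjective (weightedSumHom d) := by
  classical
  have hL := lcm_pos_of_pos hd
  have : NeZero (Finset.univ.lcm d) := ⟨hL.ne'⟩
  rw [← AddMonoidHom.range_eq_top]
  apply AddSubgroup.eq_top_of_le_card
  rw [Nat.card_zmod]
  refine Nat.le_of_dvd Nat.card_pos (Finset.lcm_dvd fun i _ => ?_)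
  have hdvd : d i ∣ Finset.univ.lcm d := Finset.dvd_lcm (Finset.mem_univ i)
  have hmem : ((Finset.univ.lcm d / d i : ℕ) : ZMod (Finset.univ.lcm d)) ∈
      (weightedSumHom d).range := by
    refine ⟨fun j => ((Pi.single i 1 : ι → ℤ) j : ZMod (d j)), ?_⟩
    rw [weightedSumHom_intCast]
    simp [Pi.single_apply, -Int.natCast_ediv]
  have hord : addOrderOf ((Finset.univ.lcm d / d i : ℕ) : ZMod (Finset.univ.lcm d)) = d i := by
    rw [ZMod.addOrderOf_coe _ hL.ne', Nat.gcd_eq_right (Nat.div_dvd_of_dvd hdvd),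
      Nat.div_div_self hdvd hL.ne']
  rw [← hord]
  exact AddSubgroup.addOrderOf_dvd_natCard _ hmem

theorem sum_lcm_div_eq_lcm {ι : Type*} [Fintype ι] {d : ι → ℕ} (hd : ∀ i, 0 < d i)
    (hsum : ∑ i, (1 : ℝ) / (d i) = 1) :
    ∑ i, ((Finset.univ.lcm d / d i : ℕ) : ℤ) = (Finset.univ.lcm d : ℕ) := by
  have h : ∑ i, ((Finset.univ.lcm d / d i : ℕ) : ℝ) = (Finset.univ.lcm d : ℕ) := by
    calc ∑ i, ((Finset.univ.lcm d / d i : ℕ) : ℝ)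
        = ∑ i, (Finset.univ.lcm d : ℕ) * ((1 : ℝ) / d i) :=
          Finset.sum_congr rfl fun i _ => by
            rw [Nat.cast_div (Finset.dvd_lcm (Finset.mem_univ i))
              (Nat.cast_ne_zero.mpr (hd i).ne'), mul_one_div]
      _ = (Finset.univ.lcm d : ℕ) := by rw [← Finset.mul_sum, hsum, mul_one]
  exact_mod_cast h

/-- Coordinatewise reduction `ℤ^ι → (∏ ℤ/dᵢℤ) / ⟨(1, …, 1)⟩`. -/
def reductionHom {ι : Type*} (d : ι → ℕ) :
    (ι → ℤ) →+ (∀ i, ZMod (d i)) ⧸ AddSubgroup.zmultiples (fun i => (1 : ZMod (d i))) :=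
  (QuotientAddGroup.mk' _).comp
    (AddMonoidHom.pi fun i => (Int.castAddHom (ZMod (d i))).comp (Pi.evalAddMonoidHom _ i))

theorem reductionHom_apply {ι : Type*} (d : ι → ℕ) (x : ι → ℤ) :
    reductionHom d x = QuotientAddGroup.mk (fun i => (x i : ZMod (d i))) := rfl

theorem reductionHom_eq_zero_iff {ι : Type*} (d : ι → ℕ) (x : ι → ℤ) :
    reductionHom d x = 0 ↔ ∃ k : ℤ, ∃ y : ι → ℤ, ∀ i, x i = k + d i * y i := by
  rw [reductionHom_apply, QuotientAddGroup.eq_zero_iff, AddSubgroup.mem_zmultiples_iff]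
  refine exists_congr fun k => ?_
  rw [funext_iff, ← Classical.skolem (p := fun i y => x i = k + d i * y)]
  refine forall_congr' fun i => ?_
  have h : (k • fun i => (1 : ZMod (d i))) i = ((k : ℤ) : ZMod (d i)) := by simp
  rw [h, ZMod.intCast_eq_intCast_iff_dvd_sub]
  exact exists_congr fun y => sub_eq_iff_eq_add'

theorem mem_Mw {n : ℕ} {w : Fin (n + 1) → ℕ} {x : Fin (n + 1) → ℤ} :
    x ∈ Mw n w ↔ ∑ i, (w i : ℤ) * x i = 0 := Iff.rfl

theorem MB_le_ker_reductionHom (n : ℕ) (d : Fin (n + 1) → ℕ) : MB n d ≤ (reductionHom d).ker := by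
  refine (AddSubgroup.closure_le _).mpr ?_
  rintro _ ⟨i, rfl⟩
  refine (reductionHom_eq_zero_iff d _).mpr ⟨-1, Pi.single i 1, fun j => ?_⟩
  by_cases h : j = i
  · subst h; simp; ring
  · simp [h]

theorem sum_lcm_div_mul_add {ι : Type*} [Fintype ι] {d : ι → ℕ} (hd : ∀ i, 0 < d i)
    (hsum : ∑ i, (1 : ℝ) / (d i) = 1) (k : ℤ) (y : ι → ℤ) :
    ∑ i, ((Finset.univ.lcm d / d i : ℕ) : ℤ) * (k + d i * y i) =
      (Finset.univ.lcm d : ℕ) * (k + ∑ i, y i) := by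
  simp only [mul_add, Finset.sum_add_distrib, ← Finset.sum_mul, sum_lcm_div_eq_lcm hd hsum,
    Finset.mul_sum]
  congr 1
  refine Finset.sum_congr rfl fun i _ => ?_
  rw [← mul_assoc, ← Nat.cast_mul, Nat.div_mul_cancel (Finset.dvd_lcm (Finset.mem_univ i))]

theorem mem_MB_of_mem_ker_reductionHom {n : ℕ} {d : Fin (n + 1) → ℕ} (hd : ∀ i, 0 < d i)
    (hsum : ∑ i, (1 : ℝ) / (d i) = 1) {x : Fin (n + 1) → ℤ}
    (hx : x ∈ Mw n (fun i => Finset.univ.lcm d / d i)) (h : reductionHom d x = 0) :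
    x ∈ MB n d := by
  obtain ⟨k, y, hy⟩ := (reductionHom_eq_zero_iff d x).mp h
  rw [mem_Mw] at hx
  simp only [hy] at hx
  rw [sum_lcm_div_mul_add hd hsum] at hx
  have hk : k + ∑ i, y i = 0 :=
    (mul_eq_zero.mp hx).resolve_left (Nat.cast_ne_zero.mpr (lcm_pos_of_pos hd).ne')
  have hxy : x = ∑ i, y i • fun j => (if j = i then (d i : ℤ) else 0) - 1 := by
    ext j
    simp only [Finset.sum_apply, Pi.smul_apply, smul_eq_mul, mul_sub, mul_one,
      Finset.sum_sub_distrib, mul_ite, mul_zero, Finset.sum_ite_eq, Finset.mem_univ, if_true]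
    rw [hy j]
    linear_combination hk
  rw [hxy]
  exact sum_mem fun i _ => zsmul_mem (AddSubgroup.subset_closure (Set.mem_range_self i)) _

/-- The map `γ̄` induced by `(a₀, …, a_n) ↦ ∑ w_i a_i mod d` on the quotient of
`∏ ℤ/d_iℤ` by the cyclic subgroup generated by `(1̄, …, 1̄)` is a well-defined surjective
homomorphism onto `ℤ/dℤ`, and `M(w)/M_B(w)` is isomorphic to its kernel. -/
theorem quotient_isomorphic_to_kernel
    (n : ℕ) (hn : 1 ≤ n) (d : Fin (n + 1) → ℕ) (hd : ∀ i, 0 < d i)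
    (hsum : ∑ i, (1 : ℝ) / (d i) = 1) :
    ∃ γbar : ((∀ i, ZMod (d i)) ⧸
        AddSubgroup.zmultiples (fun i => (1 : ZMod (d i)))) →+
        ZMod (Finset.univ.lcm d),
      (∀ a : ∀ i, ZMod (d i),
        γbar (QuotientAddGroup.mk a) =
          ∑ i, ((Finset.univ.lcm d / d i : ℕ) : ZMod (Finset.univ.lcm d)) *
            (((a i).val : ℕ) : ZMod (Finset.univ.lcm d))) ∧
      Function.Surjective γbar ∧
      Nonempty ((Mw n (fun i => Finset.univ.lcm d / d i) ⧸
          (MB n d).addSubgroupOf (Mw n (fun i => Finset.univ.lcm d / d i))) ≃+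
        γbar.ker) := by
  have hle : AddSubgroup.zmultiples (fun i => (1 : ZMod (d i))) ≤ (weightedSumHom d).ker := by
    rw [AddSubgroup.zmultiples_le, AddMonoidHom.mem_ker]
    have h := weightedSumHom_intCast d (fun _ => 1)
    simp only [mul_one, sum_lcm_div_eq_lcm hd hsum, Int.cast_natCast, ZMod.natCast_self,
      Int.cast_one] at h
    exact h
  refine ⟨QuotientAddGroup.lift _ (weightedSumHom d) hle, fun a => ?_,
    QuotientAddGroup.lift_surjective_of_surjective _ _ (weightedSumHom_surjective hd) hle, ?_⟩
  · have : ∀ i, NeZero (d i) := fun i => ⟨(hd i).ne'⟩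
    have h := weightedSumHom_intCast d (fun i => ((a i).val : ℤ))
    simp only [Int.cast_sum, Int.cast_mul, Int.cast_natCast, ZMod.natCast_zmod_val] at h
    exact h
  let φ := (reductionHom d).comp (Mw n (fun i => Finset.univ.lcm d / d i)).subtype
  have hker : (MB n d).addSubgroupOf (Mw n (fun i => Finset.univ.lcm d / d i)) = φ.ker := by
    ext ⟨x, hx⟩
    exact ⟨fun h => MB_le_ker_reductionHom n d h, mem_MB_of_mem_ker_reductionHom hd hsum hx⟩
  have hrange : φ.range = (QuotientAddGroup.lift _ (weightedSumHom d) hle).ker := by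
    ext q
    constructor
    · rintro ⟨⟨x, hx⟩, rfl⟩
      change weightedSumHom d (fun i => (x i : ZMod (d i))) = 0
      rw [weightedSumHom_intCast, mem_Mw.mp hx, Int.cast_zero]
    · induction q using QuotientAddGroup.induction_on with | H a => ?_
      intro ha
      change weightedSumHom d a = 0 at ha
      choose x hx using fun i => ZMod.intCast_surjective (a i)
      obtain rfl : (fun i => (x i : ZMod (d i))) = a := funext hx
      rw [weightedSumHom_intCast, ZMod.intCast_zmod_eq_zero_iff_dvd] at ha
      obtain ⟨k, hk⟩ := ha
      refine ⟨⟨fun i => x i - k, ?_⟩, ?_⟩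
      · simp only [mem_Mw, mul_sub, Finset.sum_sub_distrib, ← Finset.sum_mul,
          sum_lcm_div_eq_lcm hd hsum, hk, sub_self]
      · change reductionHom d (fun i => x i - k) = reductionHom d x
        rw [← sub_eq_zero, ← map_sub, reductionHom_eq_zero_iff]
        exact ⟨-k, 0, fun i => by simp⟩
  exact ⟨(QuotientAddGroup.quotientAddEquivOfEq hker).trans
    ((QuotientAddGroup.quotientKerEquivRange φ).trans (AddEquiv.addSubgroupCongr hrange))⟩
end

section
/- For n ≥ 1, let Λ ⊆ ℤⁿ be the subgroup generated by the n+1 vectors -(1, 1, …, 1) and (n+1)·e_i − (1, 1, …, 1) for i = 1, …, n, where e₁, …, e_n is the standard basis of ℤⁿ. Then the quotient group ℤⁿ/Λ is isomorphic to (ℤ/(n+1)ℤ)^{n-1}. -/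
open Finset

/-- The differences `x (i + 1) - x 0` of the coordinates of an integer vector, modulo `N`. -/
def coordDiffMod (m N : ℕ) : (Fin (m + 1) → ℤ) →+ (Fin m → ZMod N) where
  toFun x i := ((x i.succ - x 0 : ℤ) : ZMod N)
  map_zero' := by ext; simp
  map_add' x y := by ext; simp only [Pi.add_apply]; push_cast; ring

theorem coordDiffMod_apply (m N : ℕ) (x : Fin (m + 1) → ℤ) (i : Fin m) :
    coordDiffMod m N x i = ((x i.succ - x 0 : ℤ) : ZMod N) := rfl

theorem coordDiffMod_surjective (m N : ℕ) : Function.Surjective (coordDiffMod m N) := by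
  intro y
  choose z hz using fun i => ZMod.intCast_surjective (y i)
  exact ⟨Fin.cons 0 z, by ext i; simp [coordDiffMod_apply, hz]⟩

theorem closure_eq_ker_coordDiffMod (m N : ℕ) :
    AddSubgroup.closure
        (insert (fun _ => (-1 : ℤ))
          (Set.range fun i : Fin (m + 1) =>
            fun j => (N : ℤ) * (if j = i then 1 else 0) - 1)) =
      (coordDiffMod m N).ker := by
  apply le_antisymm
  · rw [AddSubgroup.closure_le, Set.insert_subset_iff, Set.range_subset_iff]
    refine ⟨?_, fun i => ?_⟩ <;>
    · rw [SetLike.mem_coe, AddMonoidHom.mem_ker]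
      ext j
      simp [coordDiffMod_apply]
  · intro x hx
    rw [AddMonoidHom.mem_ker] at hx
    have hdvd : ∀ i, ∃ k : ℤ, x i - x 0 = N * k := by
      intro i
      cases i using Fin.cases with
      | zero => exact ⟨0, by simp⟩
      | succ i => exact (ZMod.intCast_zmod_eq_zero_iff_dvd _ N).1 (congrFun hx i)
    choose k hk using hdvd
    have hone := AddSubgroup.subset_closure (Set.mem_insert (fun _ => (-1 : ℤ))
      (Set.range fun i : Fin (m + 1) => fun j => (N : ℤ) * (if j = i then 1 else 0) - 1))
    have hgen := fun i => AddSubgroup.subset_closure (Set.mem_insert_of_mem (fun _ => (-1 : ℤ))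
      (Set.mem_range_self (f := fun i : Fin (m + 1) =>
        fun j => (N : ℤ) * (if j = i then 1 else 0) - 1) i))
    convert add_mem (zsmul_mem hone (-x 0))
      (sum_mem fun i (_ : i ∈ (univ : Finset (Fin (m + 1)))) =>
        zsmul_mem (sub_mem (hgen i) hone) (k i)) using 1
    ext j
    simp [Finset.sum_apply]
    linarith [hk j]

/-- Let `Λ ⊆ ℤⁿ` be the subgroup generated by `-(1, …, 1)` and the vectors
`(n+1)·e_i − (1, …, 1)` for `i = 1, …, n`. Then `ℤⁿ/Λ ≅ (ℤ/(n+1)ℤ)^{n-1}`. -/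
theorem quotient_by_mirror_lattice
    (n : ℕ) (hn : 1 ≤ n) :
    Nonempty (((Fin n → ℤ) ⧸ AddSubgroup.closure
        (insert (fun _ => (-1 : ℤ))
          (Set.range fun i : Fin n =>
            fun j => ((n : ℤ) + 1) * (if j = i then 1 else 0) - 1))) ≃+
      (Fin (n - 1) → ZMod (n + 1))) := by
  obtain ⟨m, rfl⟩ := Nat.exists_eq_add_of_le' hn
  have hker := closure_eq_ker_coordDiffMod m (m + 1 + 1)
  rw [Nat.cast_add_one (m + 1)] at hker
  exact ⟨(QuotientAddGroup.quotientAddEquivOfEq hker).trans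
    (QuotientAddGroup.quotientKerEquivOfSurjective _ (coordDiffMod_surjective m (m + 1 + 1)))⟩
end
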